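/- arXiv:1203.2813 — 2 statements merged into one kernel-verified Lean document; each statement's English description precedes it below -/
import Mathlib

section
/- Let K be an infinite compact subset of ℝ^d and let s_u denote the local uniform upper box dimension of K. Then the set of measures μ ∈ P(K) such that for every q > 1 the upper L^q-dimension of μ equals s_u is residual in P(K) (it contains a dense G_δ set). -/
open MeasureTheory Filter Metric Set Topology

noncomputable section

/-- `ℝ^d` with the Euclidean metric. -/
abbrev Euc (d : ℕ) : Type := EuclideanSpace ℝ (Fin d)

/-- The largest number of pairwise disjoint balls of radius `r` with centers in `E`. -/
noncomputable def packingNumber {X : Type*} [MetricSpace X] (E : Set X) (r : ℝ) : ℕ :=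
  sSup {n : ℕ | ∃ c : Fin n → X, (∀ i, c i ∈ E) ∧
    Pairwise fun i j => Disjoint (ball (c i) r) (ball (c j) r)}

/-- The smallest number of balls of radius `r` needed to cover `E`. -/
noncomputable def coveringNumber {X : Type*} [MetricSpace X] (E : Set X) (r : ℝ) : ℕ :=
  sInf {n : ℕ | ∃ c : Fin n → X, E ⊆ ⋃ i, ball (c i) r}

/-- Upper box (Minkowski) dimension. -/
noncomputable def upperBoxDim {X : Type*} [MetricSpace X] (E : Set X) : EReal :=
  limsup (fun r : ℝ => ((Real.log (coveringNumber E r : ℝ) / (-Real.log r) : ℝ) : EReal))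
    (𝓝[>] (0:ℝ))

/-- Lower box (Minkowski) dimension. -/
noncomputable def lowerBoxDim {X : Type*} [MetricSpace X] (E : Set X) : EReal :=
  liminf (fun r : ℝ => ((Real.log (coveringNumber E r : ℝ) / (-Real.log r) : ℝ) : EReal))
    (𝓝[>] (0:ℝ))

/-- Packing dimension, defined as the modified upper box dimension. -/
noncomputable def packingDim {X : Type*} [MetricSpace X] (E : Set X) : EReal :=
  ⨅ (F : ℕ → Set X) (_ : E ⊆ ⋃ n, F n), ⨆ n, upperBoxDim (F n)

/-- The local uniform upper box dimension. -/
noncomputable def locUnifUpperBoxDim {X : Type*} [MetricSpace X] (K : Set X) : EReal :=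
  ⨅ (N : ℕ) (_ : 1 ≤ N) (x : Fin N → X) (_ : ∀ i, x i ∈ K) (r₀ : ℝ) (_ : 0 < r₀),
    limsup (fun r : ℝ =>
      ((⨅ i : Fin N, Real.log (packingNumber (K ∩ ball (x i) r₀) r : ℝ) / (-Real.log r) : ℝ)
        : EReal)) (𝓝[>] (0:ℝ))

/-- The convex upper box dimension. -/
noncomputable def convUpperBoxDim {X : Type*} [MetricSpace X] (K : Set X) : EReal :=
  ⨅ (N : ℕ) (_ : 1 ≤ N) (x : Fin N → X) (_ : ∀ i, x i ∈ K) (ρ : ℝ) (_ : 0 < ρ)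
    (p : Fin N → ℝ) (_ : ∀ i, 0 < p i) (_ : ∑ i, p i = 1),
    limsup (fun r : ℝ =>
      (((∑ i, p i * Real.log (packingNumber (K ∩ ball (x i) ρ) r : ℝ)) / (-Real.log r) : ℝ)
        : EReal)) (𝓝[>] (0:ℝ))

/-- The maximal convex upper box dimension. -/
noncomputable def convUpperBoxDimMax {X : Type*} [MetricSpace X] (K : Set X) : EReal :=
  ⨆ (y : X) (_ : y ∈ K) (ρ : ℝ) (_ : 0 < ρ), convUpperBoxDim (K ∩ ball y ρ)

/-- `I_μ(r,q)`, with the logarithmic convention at `q = 1`. -/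
noncomputable def Iq {X : Type*} [MetricSpace X] [MeasurableSpace X]
    (μ : Measure X) (r q : ℝ) : ℝ :=
  if q = 1 then ∫ x, Real.log ((μ (ball x r)).toReal) ∂μ
  else ∫ x, ((μ (ball x r)).toReal) ^ (q - 1) ∂μ

/-- The quantity whose `liminf`/`limsup` as `r → 0⁺` gives the lower/upper `L^q`-dimensions. -/
noncomputable def Dq {X : Type*} [MetricSpace X] [MeasurableSpace X]
    (μ : Measure X) (r q : ℝ) : ℝ :=
  if q = 1 then Iq μ r 1 / Real.log r
  else (1 / (q - 1)) * (Real.log (Iq μ r q) / Real.log r)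

/-- The upper `L^q`-dimension of a measure. -/
noncomputable def upperDim {X : Type*} [MetricSpace X] [MeasurableSpace X]
    (μ : Measure X) (q : ℝ) : EReal :=
  limsup (fun r : ℝ => ((Dq μ r q : ℝ) : EReal)) (𝓝[>] (0:ℝ))

/-- The lower `L^q`-dimension of a measure. -/
noncomputable def lowerDim {X : Type*} [MetricSpace X] [MeasurableSpace X]
    (μ : Measure X) (q : ℝ) : EReal :=
  liminf (fun r : ℝ => ((Dq μ r q : ℝ) : EReal)) (𝓝[>] (0:ℝ))

/-- The (topological) support of a measure. -/
noncomputable def msupport {X : Type*} [MetricSpace X] [MeasurableSpace X]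
    (μ : Measure X) : Set X :=
  {x | ∀ r > (0:ℝ), 0 < μ (ball x r)}

/-- The upper `L^∞`-dimension of a measure. -/
noncomputable def upperDimInfty {X : Type*} [MetricSpace X] [MeasurableSpace X]
    (μ : Measure X) : EReal :=
  limsup (fun r : ℝ =>
    ((Real.log (⨆ x ∈ msupport μ, (μ (ball x r)).toReal) / Real.log r : ℝ) : EReal))
    (𝓝[>] (0:ℝ))

/-- The lower `L^∞`-dimension of a measure. -/
noncomputable def lowerDimInfty {X : Type*} [MetricSpace X] [MeasurableSpace X]
    (μ : Measure X) : EReal :=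
  liminf (fun r : ℝ =>
    ((Real.log (⨆ x ∈ msupport μ, (μ (ball x r)).toReal) / Real.log r : ℝ) : EReal))
    (𝓝[>] (0:ℝ))

/-- The upper `L^{-∞}`-dimension of a measure. -/
noncomputable def upperDimNegInfty {X : Type*} [MetricSpace X] [MeasurableSpace X]
    (μ : Measure X) : EReal :=
  limsup (fun r : ℝ =>
    ((Real.log (⨅ x ∈ msupport μ, (μ (ball x r)).toReal) / Real.log r : ℝ) : EReal))
    (𝓝[>] (0:ℝ))

/-- The lower `L^{-∞}`-dimension of a measure. -/
noncomputable def lowerDimNegInfty {X : Type*} [MetricSpace X] [MeasurableSpace X]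
    (μ : Measure X) : EReal :=
  liminf (fun r : ℝ =>
    ((Real.log (⨅ x ∈ msupport μ, (μ (ball x r)).toReal) / Real.log r : ℝ) : EReal))
    (𝓝[>] (0:ℝ))

/-- The half-closed dyadic cube of side `2^{-n}` indexed by `k`. -/
noncomputable def dyadicCube (d n : ℕ) (k : Fin d → ℤ) : Set (Euc d) :=
  {x | ∀ j, (k j : ℝ) / 2 ^ n ≤ x j ∧ x j < ((k j : ℝ) + 1) / 2 ^ n}

/-- `K_n`: the union of the half-closed dyadic cubes of side `2^{-n}` meeting `K`. -/
noncomputable def dyadicHull (d : ℕ) (K : Set (Euc d)) (n : ℕ) : Set (Euc d) :=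
  ⋃ (k : Fin d → ℤ) (_ : (dyadicCube d n k ∩ K).Nonempty), dyadicCube d n k

/-- The number of connected components of a set. -/
noncomputable def numComponents {X : Type*} [TopologicalSpace X] (S : Set X) : ℕ :=
  Nat.card {C : Set X // ∃ x ∈ S, C = connectedComponentIn S x}

/-- The box separation index `bsi(K)`. -/
noncomputable def bsi (d : ℕ) (K : Set (Euc d)) : ℝ :=
  liminf (fun n : ℕ =>
    Real.log (numComponents (dyadicHull d K n) : ℝ) / (n * Real.log 2)) atTop

/-- The Fortet–Mourier distance between two measures. -/
noncomputable def FMdist {X : Type*} [MetricSpace X] [MeasurableSpace X]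
    (μ ν : Measure X) : ℝ :=
  ⨆ f : {f : X → ℝ // LipschitzWith 1 f ∧ ∀ x, |f x| ≤ 1},
    |∫ x, f.1 x ∂μ - ∫ x, f.1 x ∂ν|


section Packing

variable {X : Type*} [MetricSpace X] {E : Set X} {r : ℝ}

lemma le_dist_of_disjoint_ball {x y : X} (hr : 0 < r) (h : Disjoint (ball x r) (ball y r)) :
    r ≤ dist x y := by
  by_contra! hlt
  exact Set.disjoint_left.1 h (mem_ball_self hr) hlt

/-- Pairwise disjoint balls of a fixed radius with centers in a totally bounded set are bounded
in number. -/
lemma bddAbove_packing (hE : TotallyBounded E) (hr : 0 < r) :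
    BddAbove {n : ℕ | ∃ c : Fin n → X, (∀ i, c i ∈ E) ∧
      Pairwise fun i j => Disjoint (ball (c i) r) (ball (c j) r)} := by
  obtain ⟨t, ht, hEt⟩ := Metric.totallyBounded_iff.1 hE (r / 2) (by positivity)
  refine ⟨ht.toFinset.card, ?_⟩
  rintro n ⟨c, hcE, hc⟩
  have hmem : ∀ i, ∃ y ∈ t, c i ∈ ball y (r / 2) := fun i => by
    simpa using hEt (hcE i)
  choose f hft hf using hmem
  have hinj : Function.Injective f := by
    intro i j hij
    by_contra hne
    have h1 := le_dist_of_disjoint_ball hr (hc hne)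
    have h2 := dist_triangle_right (c i) (c j) (f i)
    have h3 := mem_ball.1 (hf i)
    have h4 := mem_ball.1 (hf j)
    rw [← hij] at h4
    linarith
  simpa using Finset.card_le_card_of_injOn f (s := Finset.univ) (t := ht.toFinset)
    (fun i _ => by simpa using hft i) hinj.injOn

/-- A maximal packing exists, and the balls of doubled radius cover. -/
lemma exists_maximal_packing (hE : TotallyBounded E) (hr : 0 < r) :
    ∃ c : Fin (packingNumber E r) → X, (∀ i, c i ∈ E) ∧
      (Pairwise fun i j => Disjoint (ball (c i) r) (ball (c j) r)) ∧
      ∀ x ∈ E, ∃ i, dist x (c i) < 2 * r := by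
  have hb := bddAbove_packing hE hr
  have hmax : packingNumber E r ∈ {n : ℕ | ∃ c : Fin n → X, (∀ i, c i ∈ E) ∧
      Pairwise fun i j => Disjoint (ball (c i) r) (ball (c j) r)} :=
    Nat.sSup_mem ⟨0, Fin.elim0, fun i => i.elim0, fun i => i.elim0⟩ hb
  obtain ⟨c, hcE, hc⟩ := hmax
  refine ⟨c, hcE, hc, ?_⟩
  intro x hx
  by_contra! hfar
  have hdisj : ∀ i, Disjoint (ball x r) (ball (c i) r) := fun i =>
    ball_disjoint_ball (by linarith [hfar i])
  have hle : packingNumber E r + 1 ≤ packingNumber E r := by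
    refine le_csSup hb ⟨Fin.cons x c, ?_, ?_⟩
    · intro i
      refine Fin.cases hx hcE i
    · intro i j
      refine Fin.cases ?_ (fun i => ?_) i <;> refine Fin.cases ?_ (fun j => ?_) j
      · simp
      · intro _
        simpa only [Fin.cons_zero, Fin.cons_succ] using hdisj j
      · intro _
        simpa only [Fin.cons_zero, Fin.cons_succ] using (hdisj i).symm
      · intro hij
        simpa only [Fin.cons_succ] using hc (fun h => hij (by rw [h]))
  omega

lemma one_le_packingNumber (hE : TotallyBounded E) (hr : 0 < r) (hne : E.Nonempty) :
    1 ≤ packingNumber E r := by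
  obtain ⟨x, hx⟩ := hne
  refine le_csSup (bddAbove_packing hE hr) ⟨fun _ => x, fun _ => hx, fun i j hij => ?_⟩
  exact absurd (Subsingleton.elim i j) hij

end Packing

section WeakTopology

variable {Y : Type*} [MetricSpace Y] [MeasurableSpace Y] [BorelSpace Y]

lemma isOpen_setOf_lt_measure {U : Set Y} (hU : IsOpen U) (a : ENNReal) :
    IsOpen {μ : ProbabilityMeasure Y | a < (μ : Measure Y) U} := by
  rw [isOpen_iff_mem_nhds]
  intro μ hμ
  have hpos : 0 < (μ : Measure Y) U - a := tsub_pos_of_lt hμ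
  filter_upwards [ProbabilityMeasure.toMeasure_add_pos_gt_mem_nhds μ hU hpos] with ν hν
  by_contra hle
  have hle' : (ν : Measure Y) U ≤ a := not_lt.1 hle
  have h1 : (ν : Measure Y) U + ((μ : Measure Y) U - a) ≤ (μ : Measure Y) U := by
    calc _ ≤ a + ((μ : Measure Y) U - a) := by gcongr
      _ = _ := add_tsub_cancel_of_le (le_of_lt hμ)
  exact absurd hν (not_lt.2 h1)

lemma isOpen_setOf_measure_lt {F : Set Y} (hF : IsClosed F) (a : ℝ) :
    IsOpen {μ : ProbabilityMeasure Y | (μ : Measure Y).real F < a} := by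
  have : {μ : ProbabilityMeasure Y | (μ : Measure Y).real F < a} =
      {μ : ProbabilityMeasure Y | 1 < a} ∪
      {μ : ProbabilityMeasure Y | ENNReal.ofReal (1 - a) < (μ : Measure Y) Fᶜ} := by
    ext μ
    simp only [Set.mem_ofPred_eq, Set.mem_union]
    have h1 : (μ : Measure Y).real Fᶜ = 1 - (μ : Measure Y).real F := by
      rw [measureReal_compl hF.measurableSet]; simp
    have h0 : (μ : Measure Y).real F ≤ 1 := measureReal_le_one
    rw [← ofReal_measureReal (μ := (μ : Measure Y)) (s := Fᶜ), ENNReal.ofReal_lt_ofReal_iff']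
    constructor
    · intro h
      rcases lt_or_ge 1 a with ha | ha
      · exact Or.inl ha
      · exact Or.inr ⟨by linarith, by linarith⟩
    · rintro (h | ⟨h, -⟩) <;> linarith
  rw [this]
  exact isOpen_const.union (isOpen_setOf_lt_measure hF.isOpen_compl _)

/-- A one-sided Lévy–Prokhorov criterion for being a weak limit of measures in `S`. -/
lemma mem_closure_of_forall_measure_le_thickening [TopologicalSpace.SeparableSpace Y]
    {S : Set (ProbabilityMeasure Y)} {μ : ProbabilityMeasure Y}
    (h : ∀ ε > 0, ∃ ν ∈ S, ∀ B, MeasurableSet B →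
      (ν : Measure Y) B ≤ (μ : Measure Y) (thickening ε B) + ENNReal.ofReal ε) :
    μ ∈ closure S := by
  have e := (LevyProkhorov.probabilityMeasureHomeomorph (Ω := Y)).isInducing
  rw [e.closure_eq_preimage_closure_image, Set.mem_preimage, Metric.mem_closure_iff]
  intro ε hε
  obtain ⟨ν, hν, hle⟩ := h (ε / 2) (by positivity)
  refine ⟨_, Set.mem_image_of_mem _ hν, ?_⟩
  rw [dist_comm, LevyProkhorov.dist_probabilityMeasure_def]
  refine lt_of_le_of_lt (levyProkhorovDist_le_of_forall_le _ _ (δ := ε / 2) (by positivity) ?_)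
    (half_lt_self hε)
  intro δ B hδ hB
  exact (hle B hB).trans
    (add_le_add (measure_mono (thickening_mono hδ.le B)) (ENNReal.ofReal_le_ofReal hδ.le))

/-- Measures charging a given nonempty open set are dense. -/
lemma dense_setOf_measure_pos [TopologicalSpace.SeparableSpace Y] {U : Set Y} (hU : U.Nonempty) :
    Dense {μ : ProbabilityMeasure Y | 0 < (μ : Measure Y) U} := by
  intro μ
  obtain ⟨x, hx⟩ := hU
  refine mem_closure_of_forall_measure_le_thickening fun ε hε => ?_
  set t : ℝ := min ε 1
  have ht0 : 0 < t := lt_min hε one_pos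
  have ht1 : t ≤ 1 := min_le_right _ _
  let ν : Measure Y := ENNReal.ofReal (1 - t) • (μ : Measure Y) +
    ENNReal.ofReal t • Measure.dirac x
  have hν : IsProbabilityMeasure ν := ⟨by
    simp only [ν, Measure.add_apply, Measure.smul_apply, measure_univ, smul_eq_mul, mul_one]
    rw [← ENNReal.ofReal_add (by linarith) ht0.le]
    simp⟩
  refine ⟨⟨ν, hν⟩, ?_, fun B hB => ?_⟩
  · have : 0 < ENNReal.ofReal t * Measure.dirac x U := by
      rw [Measure.dirac_apply_of_mem hx, mul_one]
      exact ENNReal.ofReal_pos.2 ht0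
    exact this.trans_le (by simp [ν])
  · change ν B ≤ _
    simp only [ν, Measure.add_apply, Measure.smul_apply, smul_eq_mul]
    gcongr
    · calc _ ≤ 1 * (μ : Measure Y) B := by
            gcongr
            exact ENNReal.ofReal_le_one.2 (by linarith)
        _ ≤ _ := by
            rw [one_mul]
            exact measure_mono (self_subset_thickening hε _)
    · calc _ ≤ ENNReal.ofReal t * 1 := by
            gcongr
            exact prob_le_one
        _ ≤ _ := by
            rw [mul_one]
            exact ENNReal.ofReal_le_ofReal (min_le_left _ _)

end WeakTopology

lemma Dq_le_of_le_Iq {Y : Type*} [MetricSpace Y] [MeasurableSpace Y] {μ : Measure Y} {r q : ℝ}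
    (hr0 : 0 < r) (hr1 : r < 1) (hq : 1 < q) {m : ℝ} (hm : 0 < m)
    {P : ℕ} (hP : 1 ≤ P) (h : m / 2 * (m / (2 * P)) ^ (q - 1) ≤ Iq μ r q) :
    Dq μ r q ≤ (q / (q - 1) * (-Real.log (m / 2)) + Real.log P) / (-Real.log r) := by
  have hP' : (0 : ℝ) < P := by exact_mod_cast hP
  have hq' : 0 < q - 1 := by linarith
  have hL : 0 < -Real.log r := by linarith [Real.log_neg hr0 hr1]
  have h1 := Real.log_le_log (by positivity) h
  rw [Real.log_mul (by positivity) (by positivity), Real.log_rpow (by positivity),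
    show m / (2 * P) = m / 2 / P by field_simp,
    Real.log_div (x := m / 2) (by positivity) (by positivity)] at h1
  rw [Dq, if_neg hq.ne', show 1 / (q - 1) * (Real.log (Iq μ r q) / Real.log r) =
    (-Real.log (Iq μ r q) / (q - 1)) / (-Real.log r) by
      have : Real.log r ≠ 0 := by linarith
      field_simp]
  gcongr
  rw [div_le_iff₀ hq']
  have : (q / (q - 1) * (-Real.log (m / 2)) + Real.log P) * (q - 1) =
    -q * Real.log (m / 2) + (q - 1) * Real.log P := by field_simp
  rw [this]
  linarith

section Moments

variable {Y : Type*} [MetricSpace Y] [SecondCountableTopology Y] [MeasurableSpace Y]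
  [BorelSpace Y] {μ : Measure Y} [IsProbabilityMeasure μ] {r q : ℝ}

lemma integrable_measure_ball_rpow (hq : 1 < q) :
    Integrable (fun x => (μ (ball x r)).toReal ^ (q - 1)) μ := by
  have hmeas : Measurable fun x => μ (ball x r) :=
    measurable_measure_prodMk_left (ν := μ) (s := {p : Y × Y | dist p.2 p.1 < r})
      (isOpen_lt (by fun_prop) continuous_const).measurableSet
  refine Integrable.of_bound (hmeas.ennreal_toReal.pow_const _).aestronglyMeasurable 1
    (ae_of_all _ fun x => ?_)
  rw [Real.norm_of_nonneg (by positivity)]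
  exact Real.rpow_le_one ENNReal.toReal_nonneg measureReal_le_one (by linarith)

/-- If a set of mass `m` is covered by `P` balls of radius `r / 2`, then at least half of its mass
lies in balls of mass at least `m / (2 * P)`. -/
lemma le_Iq_of_subset_iUnion_ball (hq : 1 < q) {P : ℕ} {c : Fin P → Y} {B : Set Y}
    (hB : B ⊆ ⋃ j, ball (c j) (r / 2)) :
    μ.real B / 2 * (μ.real B / (2 * P)) ^ (q - 1) ≤ Iq μ r q := by
  set m := μ.real B
  set a := m / (2 * P)
  have hm : 0 ≤ m := measureReal_nonneg
  have ha : 0 ≤ a := by positivity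
  let J : Finset (Fin P) := Finset.univ.filter fun j => μ.real (ball (c j) (r / 2)) < a
  set bad : Set Y := ⋃ j ∈ J, ball (c j) (r / 2)
  have hbad : μ.real bad ≤ m / 2 := by
    calc μ.real bad ≤ ∑ j ∈ J, μ.real (ball (c j) (r / 2)) := measureReal_biUnion_finset_le _ _
      _ ≤ ∑ j ∈ J, a := Finset.sum_le_sum fun j hj => (Finset.mem_filter.1 hj).2.le
      _ = J.card * a := by simp
      _ ≤ P * a := by
          gcongr
          simpa using Finset.card_le_univ J
      _ ≤ m / 2 := by
          rcases Nat.eq_zero_or_pos P with hP | hP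
          · simp only [hP, Nat.cast_zero, zero_mul]; positivity
          · have : (0 : ℝ) < P := by exact_mod_cast hP
            refine le_of_eq ?_
            simp only [a]
            field_simp
  have hgood : m / 2 ≤ μ.real (B \ bad) := by
    have h1 : m ≤ μ.real bad + μ.real (B \ bad) :=
      (measureReal_mono (by intro x hx; by_cases h : x ∈ bad <;> simp [h, hx])).trans
        (measureReal_union_le _ _)
    linarith
  have hsub : B \ bad ⊆ {x | a ^ (q - 1) ≤ (μ (ball x r)).toReal ^ (q - 1)} := by
    rintro x ⟨hxB, hxbad⟩
    obtain ⟨j, hj⟩ := Set.mem_iUnion.1 (hB hxB)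
    have hj' : a ≤ μ.real (ball (c j) (r / 2)) := by
      by_contra! hlt
      exact hxbad (Set.mem_biUnion (x := j) (by simpa [J] using hlt) hj)
    refine Real.rpow_le_rpow ha (hj'.trans ?_) (by linarith)
    refine measureReal_mono (ball_subset_ball' ?_)
    rw [dist_comm]
    linarith [mem_ball.1 hj]
  have hmarkov := mul_meas_ge_le_integral_of_nonneg (μ := μ)
    (ae_of_all _ fun x => by positivity)
    (integrable_measure_ball_rpow (μ := μ) (r := r) hq) (a ^ (q - 1))
  rw [Iq, if_neg hq.ne']
  refine le_trans ?_ hmarkov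
  rw [mul_comm]
  gcongr
  exact hgood.trans (measureReal_mono hsub)

lemma le_Dq_of_measure_ball_le (hr0 : 0 < r) (hr1 : r < 1) (hq : 1 < q) {s : ℝ}
    (hI : 0 < Iq μ r q) (h : ∀ x, μ.real (ball x r) ≤ r ^ s) : s ≤ Dq μ r q := by
  have hq' : 0 < q - 1 := by linarith
  have hL : 0 < -Real.log r := by linarith [Real.log_neg hr0 hr1]
  have hle : Iq μ r q ≤ (r ^ s) ^ (q - 1) := by
    rw [Iq, if_neg hq.ne']
    calc _ ≤ ∫ _, (r ^ s) ^ (q - 1) ∂μ :=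
          integral_mono (integrable_measure_ball_rpow hq) (integrable_const _) fun x =>
            Real.rpow_le_rpow ENNReal.toReal_nonneg (h x) hq'.le
      _ = _ := by simp
  have h1 := Real.log_le_log hI hle
  rw [Real.log_rpow (by positivity), Real.log_rpow hr0] at h1
  rw [Dq, if_neg hq.ne', show 1 / (q - 1) * (Real.log (Iq μ r q) / Real.log r) =
    (-Real.log (Iq μ r q)) / ((q - 1) * (-Real.log r)) by
      have : Real.log r ≠ 0 := by linarith
      field_simp]
  rw [le_div_iff₀ (by positivity)]
  linarith

end Moments

lemma tendsto_neg_log_nhdsGT_zero : Tendsto (fun r : ℝ => -Real.log r) (𝓝[>] 0) atTop :=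
  tendsto_neg_atBot_atTop.comp Real.tendsto_log_nhdsGT_zero

lemma upperDim_le_locUnifUpperBoxDim {X : Type*} [MetricSpace X] [MeasurableSpace X]
    [BorelSpace X] {K : Set X} (hK : IsCompact K) (μ : Measure K) [IsProbabilityMeasure μ]
    (hμ : ∀ U : Set K, IsOpen U → U.Nonempty → 0 < μ U) {q : ℝ} (hq : 1 < q) :
    upperDim μ q ≤ locUnifUpperBoxDim K := by
  have : CompactSpace K := isCompact_iff_compactSpace.1 hK
  simp only [locUnifUpperBoxDim, le_iInf_iff]
  intro N hN x hx r₀ hr₀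
  have : Nonempty (Fin N) := ⟨⟨0, hN⟩⟩
  refine EReal.le_of_forall_lt_iff_le.1 fun t ht => ?_
  have hF := eventually_lt_of_limsup_lt ht
  have hscale : Tendsto (fun r : ℝ => r / 4) (𝓝[>] 0) (𝓝[>] 0) := by
    refine tendsto_nhdsWithin_iff.2 ⟨?_, ?_⟩
    · have : Tendsto (fun r : ℝ => r / 4) (𝓝 0) (𝓝 (0 / 4)) := tendsto_id.div_const 4
      rw [zero_div] at this
      exact this.mono_left nhdsWithin_le_nhds
    · filter_upwards [self_mem_nhdsWithin] with r hr
      exact div_pos (Set.mem_Ioi.1 hr) four_pos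
  have htb : ∀ i, TotallyBounded (K ∩ ball (x i) r₀) := fun i =>
    hK.totallyBounded.subset Set.inter_subset_left
  let y : Fin N → K := fun i => ⟨x i, hx i⟩
  have hm : ∀ i, 0 < μ.real (ball (y i) r₀) := fun i =>
    ENNReal.toReal_pos (hμ _ isOpen_ball ⟨y i, mem_ball_self hr₀⟩).ne' (measure_ne_top _ _)
  obtain ⟨C, hC⟩ : ∃ C, ∀ i, q / (q - 1) * (-Real.log (μ.real (ball (y i) r₀) / 2)) ≤ C := by
    obtain ⟨C, hC⟩ := (Set.finite_range fun i =>
      q / (q - 1) * (-Real.log (μ.real (ball (y i) r₀) / 2))).bddAbove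
    exact ⟨C, fun i => hC ⟨i, rfl⟩⟩
  have hlim : Tendsto (fun r : ℝ => ((t + (C + t * Real.log 4) / (-Real.log r) : ℝ) : EReal))
      (𝓝[>] 0) (𝓝 (t : EReal)) := by
    rw [EReal.tendsto_coe]
    simpa using (tendsto_const_nhds (x := t)).add
      (tendsto_neg_log_nhdsGT_zero.const_div_atTop (C + t * Real.log 4))
  rw [← hlim.limsup_eq]
  refine limsup_le_limsup ?_
  filter_upwards [hscale.eventually hF, self_mem_nhdsWithin,
    mem_nhdsWithin_of_mem_nhds (Iio_mem_nhds one_pos)] with r hr hr0 hr1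
  simp only [Set.mem_Ioi, Set.mem_Iio] at hr0 hr1
  rw [EReal.coe_lt_coe_iff] at hr
  obtain ⟨i, hi⟩ := exists_eq_ciInf_of_finite (f := fun i : Fin N =>
    Real.log (packingNumber (K ∩ ball (x i) r₀) (r / 4) : ℝ) / (-Real.log (r / 4)))
  rw [← hi] at hr
  have hL : 0 < -Real.log r := by linarith [Real.log_neg hr0 hr1]
  have hL4 : -Real.log (r / 4) = -Real.log r + Real.log 4 := by
    rw [Real.log_div hr0.ne' (by norm_num)]; ring
  have hlog4 : 0 < Real.log 4 := Real.log_pos (by norm_num)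
  rw [hL4, div_lt_iff₀ (by linarith)] at hr
  obtain ⟨c, hcE, -, hcov⟩ := exists_maximal_packing (htb i) (show 0 < r / 4 by positivity)
  have hP := one_le_packingNumber (htb i) (show 0 < r / 4 by positivity)
    ⟨x i, hx i, mem_ball_self hr₀⟩
  have hIq := le_Iq_of_subset_iUnion_ball (μ := μ) (r := r) hq
    (c := fun j => (⟨c j, (hcE j).1⟩ : K)) (B := ball (y i) r₀) (by
      intro z hz
      obtain ⟨j, hj⟩ := hcov z ⟨z.2, hz⟩
      refine Set.mem_iUnion.2 ⟨j, ?_⟩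
      rw [mem_ball, Subtype.dist_eq]
      linarith)
  have hDq := Dq_le_of_le_Iq hr0 hr1 hq (hm i) hP hIq
  refine EReal.coe_le_coe_iff.2 (hDq.trans ?_)
  rw [show t + (C + t * Real.log 4) / (-Real.log r) =
    (C + t * (-Real.log r + Real.log 4)) / (-Real.log r) by
      have : Real.log r ≠ 0 := by linarith
      field_simp
      ring]
  gcongr
  exact hC i

/-- Probability measures for which, at some scale `r < 1 / (n + 1)`, all balls of radius `r` have
mass less than `r ^ s`, witnessed by finitely many closed balls of radius `2 * r`. -/
def smallBallMassSet (Y : Type*) [MetricSpace Y] [MeasurableSpace Y] (s : ℝ) (n : ℕ) :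
    Set (ProbabilityMeasure Y) :=
  {μ | ∃ r : ℝ, 0 < r ∧ r < 1 / ((n : ℝ) + 1) ∧ ∃ T : Finset Y, (∀ x, ∃ c ∈ T, dist x c < r) ∧
    ∀ c ∈ T, (μ : Measure Y).real (closedBall c (2 * r)) < r ^ s}

lemma isOpen_smallBallMassSet {Y : Type*} [MetricSpace Y] [MeasurableSpace Y] [BorelSpace Y]
    (s : ℝ) (n : ℕ) : IsOpen (smallBallMassSet Y s n) := by
  refine isOpen_iff_mem_nhds.2 fun μ => ?_
  rintro ⟨r, hr0, hrn, T, hT, hμ⟩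
  have hopen : IsOpen (⋂ c ∈ T, {ν : ProbabilityMeasure Y |
      (ν : Measure Y).real (closedBall c (2 * r)) < r ^ s}) :=
    isOpen_biInter_finset fun c _ => isOpen_setOf_measure_lt isClosed_closedBall _
  refine mem_of_superset (hopen.mem_nhds (Set.mem_iInter₂.2 hμ)) fun ν hν => ?_
  exact ⟨r, hr0, hrn, T, hT, fun c hc => Set.mem_iInter₂.1 hν c hc⟩

lemma le_upperDim_of_mem_smallBallMassSet {Y : Type*} [MetricSpace Y]
    [SecondCountableTopology Y] [MeasurableSpace Y] [BorelSpace Y] {μ : ProbabilityMeasure Y}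
    {s q : ℝ} (hq : 1 < q) (hI : ∀ r > 0, 0 < Iq (μ : Measure Y) r q)
    (h : ∀ n, μ ∈ smallBallMassSet Y s n) : (s : EReal) ≤ upperDim (μ : Measure Y) q := by
  refine le_limsup_of_frequently_le ?_
  rw [frequently_iff]
  intro V hV
  obtain ⟨δ, hδ, hδV⟩ := mem_nhdsGT_iff_exists_Ioo_subset.1 hV
  obtain ⟨n, hn⟩ := exists_nat_one_div_lt (Set.mem_Ioi.1 hδ)
  obtain ⟨r, hr0, hrn, T, hT, hμ⟩ := h n
  have hr1 : r < 1 := hrn.trans_le ((div_le_one (by positivity)).2 (by simp))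
  refine ⟨r, hδV ⟨hr0, hrn.trans hn⟩, EReal.coe_le_coe_iff.2 ?_⟩
  refine le_Dq_of_measure_ball_le hr0 hr1 hq (hI r hr0) fun x => ?_
  obtain ⟨c, hc, hxc⟩ := hT x
  refine (measureReal_mono fun z hz => ?_).trans (hμ c hc).le
  rw [mem_closedBall]
  linarith [dist_triangle z x c, mem_ball.1 hz]

lemma Iq_pos {Y : Type*} [MetricSpace Y] [CompactSpace Y] [MeasurableSpace Y] [BorelSpace Y]
    (μ : Measure Y) [IsProbabilityMeasure μ] {r q : ℝ} (hr : 0 < r) (hq : 1 < q) :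
    0 < Iq μ r q := by
  have := nonempty_of_isProbabilityMeasure μ
  have hE : TotallyBounded (Set.univ : Set Y) := isCompact_univ.totallyBounded
  have hr4 : 0 < r / 4 := by positivity
  obtain ⟨c, -, -, hcov⟩ := exists_maximal_packing hE hr4
  have hP : (0 : ℝ) < packingNumber (Set.univ : Set Y) (r / 4) := by
    exact_mod_cast one_le_packingNumber hE hr4 Set.univ_nonempty
  refine lt_of_lt_of_le ?_ (le_Iq_of_subset_iUnion_ball (μ := μ) hq (c := c) (B := Set.univ) ?_)
  · simp only [probReal_univ]
    positivity
  · intro z hz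
    obtain ⟨j, hj⟩ := hcov z hz
    exact Set.mem_iUnion.2 ⟨j, by rw [mem_ball]; linarith⟩

lemma exists_measurable_index {Y : Type*} [MetricSpace Y] [CompactSpace Y] [Nonempty Y]
    [MeasurableSpace Y] [BorelSpace Y] {ε : ℝ} (hε : 0 < ε) :
    ∃ (N : ℕ) (e : Fin (N + 1) → Y) (idx : Y → Fin (N + 1)), Measurable idx ∧
      ∀ y, dist y (e (idx y)) < ε := by
  let e := TopologicalSpace.denseSeq Y
  obtain ⟨t, ht⟩ := isCompact_univ.elim_finite_subcover (fun n => ball (e n) ε)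
    (fun _ => isOpen_ball) (fun y _ => by
      obtain ⟨n, hn⟩ := (TopologicalSpace.denseRange_denseSeq Y).exists_dist_lt y hε
      exact Set.mem_iUnion.2 ⟨n, hn⟩)
  let N := t.sup id
  refine ⟨N, fun i => e i, fun y => ⟨SimpleFunc.nearestPtInd e N y,
    Nat.lt_succ_of_le (SimpleFunc.nearestPtInd_le _ _ _)⟩, ?_, fun y => ?_⟩
  · refine measurable_to_countable' fun i => ?_
    convert (SimpleFunc.nearestPtInd e N).measurableSet_preimage {(i : ℕ)} using 1
    ext y
    simp [Fin.ext_iff]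
  · obtain ⟨n, hn, hyn⟩ := Set.mem_iUnion₂.1 (ht (Set.mem_univ y))
    have h1 := SimpleFunc.edist_nearestPt_le e y (Finset.le_sup (f := id) hn)
    have h2 : edist (e n) y < ENNReal.ofReal ε := by
      rw [edist_comm, edist_lt_ofReal]
      exact hyn
    have h3 : edist (SimpleFunc.nearestPt e N y) y < ENNReal.ofReal ε := h1.trans_lt h2
    rw [edist_comm, edist_lt_ofReal] at h3
    exact h3

/-- The uniform distribution on a maximal packing of `K ∩ ball y r₀`. -/
lemma exists_measure_closedBall_le_inv_packingNumber {X : Type*} [MetricSpace X]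
    [MeasurableSpace X] [BorelSpace X] {K : Set X} (hK : IsCompact K) (y : K) {r₀ r ρ : ℝ}
    (hr₀ : 0 < r₀) (hr : 0 < r) (hρ : ρ < r / 2) :
    ∃ κ : Measure K, IsProbabilityMeasure κ ∧ κ (ball y r₀)ᶜ = 0 ∧
      ∀ z, κ (closedBall z ρ) ≤ (packingNumber (K ∩ ball (y : X) r₀) r : ENNReal)⁻¹ := by
  have htb : TotallyBounded (K ∩ ball (y : X) r₀) := hK.totallyBounded.subset Set.inter_subset_left
  set P := packingNumber (K ∩ ball (y : X) r₀) r
  obtain ⟨c, hcE, hdisj, -⟩ : ∃ c : Fin P → X, _ := exists_maximal_packing htb hr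
  have hP : 1 ≤ P := one_le_packingNumber htb hr ⟨y, y.2, mem_ball_self hr₀⟩
  let c' : Fin P → K := fun j => ⟨c j, (hcE j).1⟩
  have hsep : ∀ i j, dist (c' i) (c' j) < r → i = j := fun i j hij => by
    by_contra hne
    exact absurd (le_dist_of_disjoint_ball hr (hdisj hne)) (not_le.2 hij)
  have hinj : Function.Injective c' := fun i j hij => hsep i j (by rw [hij, dist_self]; exact hr)
  have hfin : (Set.range c').Finite := Set.finite_range c'
  have hcard : Measure.count (Set.range c') = (P : ENNReal) := by
    rw [Measure.count_apply hfin.measurableSet, ← Set.image_univ, hinj.encard_image]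
    simp
  have hκ := ProbabilityTheory.isProbabilityMeasure_uniformOn hfin ⟨_, ⟨⟨0, hP⟩, rfl⟩⟩
  refine ⟨ProbabilityTheory.uniformOn (Set.range c'), hκ, ?_, fun z => ?_⟩
  · rw [ProbabilityTheory.uniformOn_eq_zero_iff hfin, Set.eq_empty_iff_forall_notMem]
    rintro _ ⟨⟨j, rfl⟩, hj⟩
    exact hj (hcE j).2
  · rw [ProbabilityTheory.uniformOn, ProbabilityTheory.cond_apply hfin.measurableSet, hcard]
    have hsub : (Set.range c' ∩ closedBall z ρ).Subsingleton := by
      rintro _ ⟨⟨i, rfl⟩, hi⟩ _ ⟨⟨j, rfl⟩, hj⟩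
      rw [hsep i j]
      have := dist_triangle_right (c' i) (c' j) z
      linarith [mem_closedBall.1 hi, mem_closedBall.1 hj]
    have hle : Measure.count (Set.range c' ∩ closedBall z ρ) ≤ 1 := by
      rw [Measure.count_apply (hfin.measurableSet.inter isClosed_closedBall.measurableSet)]
      exact_mod_cast Set.encard_le_one_iff_subsingleton.2 hsub
    calc _ ≤ (P : ENNReal)⁻¹ * 1 := by gcongr
      _ = _ := mul_one _

lemma dense_smallBallMassSet {X : Type*} [MetricSpace X] [MeasurableSpace X]
    [BorelSpace X] {K : Set X} (hK : IsCompact K) {s : ℝ}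
    (hs : (s : EReal) < locUnifUpperBoxDim K) (n : ℕ) : Dense (smallBallMassSet K s n) := by
  have : CompactSpace K := isCompact_iff_compactSpace.1 hK
  intro μ
  have : Nonempty K := nonempty_of_isProbabilityMeasure (μ : Measure K)
  refine mem_closure_of_forall_measure_le_thickening fun ε hε => ?_
  obtain ⟨N, e, idx, hidx, hdist⟩ := exists_measurable_index (Y := K) (half_pos hε)
  obtain ⟨s', hss', hs'⟩ := EReal.lt_iff_exists_real_btwn.1 hs
  rw [EReal.coe_lt_coe_iff] at hss'
  have hlim : (s' : EReal) < limsup (fun r : ℝ => ((⨅ i : Fin (N + 1),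
      Real.log (packingNumber (K ∩ ball (e i : X) (ε / 2)) r : ℝ) / (-Real.log r) : ℝ) : EReal))
      (𝓝[>] (0 : ℝ)) := by
    refine hs'.trans_le ?_
    exact iInf_le_of_le (N + 1) (iInf_le_of_le (by omega) (iInf_le_of_le (fun i => (e i : X))
      (iInf_le_of_le (fun i => (e i).2) (iInf_le_of_le (ε / 2)
        (iInf_le_of_le (half_pos hε) le_rfl)))))
  have hfreq := frequently_lt_of_lt_limsup (by isBoundedDefault) hlim
  have hsmall : ∀ᶠ r : ℝ in 𝓝[>] 0, s * Real.log 8 ≤ (s' - s) * (-Real.log r) :=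
    (tendsto_neg_log_nhdsGT_zero.const_mul_atTop (sub_pos.2 hss')).eventually_ge_atTop _
  have hn : (0 : ℝ) < 1 / ((n : ℝ) + 1) := by positivity
  obtain ⟨r, ⟨⟨hr, hrs⟩, hr0, hr1⟩, -, hrn⟩ := (((hfreq.and_eventually hsmall).and_eventually
    (Ioo_mem_nhdsGT one_pos)).and_eventually (Ioo_mem_nhdsGT hn)).exists
  rw [EReal.coe_lt_coe_iff] at hr
  have hL : 0 < -Real.log r := by linarith [Real.log_neg hr0 hr1]
  have hlog8 : Real.log (r / 8) = Real.log r - Real.log 8 :=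
    Real.log_div hr0.ne' (by norm_num)
  have hinv : ∀ i, ((packingNumber (K ∩ ball (e i : X) (ε / 2)) r : ℝ))⁻¹ < (r / 8) ^ s := by
    intro i
    have hP := one_le_packingNumber (hK.totallyBounded.subset Set.inter_subset_left) hr0
      (E := K ∩ ball (e i : X) (ε / 2)) ⟨e i, (e i).2, mem_ball_self (half_pos hε)⟩
    have hP' : (0 : ℝ) < packingNumber (K ∩ ball (e i : X) (ε / 2)) r := by exact_mod_cast hP
    have hi := hr.trans_le (ciInf_le (Set.finite_range _).bddBelow i)
    rw [lt_div_iff₀ hL] at hi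
    rw [← Real.log_lt_log_iff (by positivity) (by positivity), Real.log_inv,
      Real.log_rpow (by positivity), hlog8]
    linarith
  have hκ := fun i => exists_measure_closedBall_le_inv_packingNumber hK (e i) (half_pos hε) hr0
    (show 2 * (r / 8) < r / 2 by linarith)
  choose κ hκprob hκsupp hκball using hκ
  have hmeas : Measurable fun y => κ (idx y) := (measurable_of_countable κ).comp hidx
  let ν : Measure K := (μ : Measure K).bind fun y => κ (idx y)
  have hν : IsProbabilityMeasure ν :=
    isProbabilityMeasure_bind hmeas.aemeasurable (ae_of_all _ fun y => hκprob _)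
  refine ⟨⟨ν, hν⟩, ?_, fun B hB => ?_⟩
  · obtain ⟨T, hT⟩ := isCompact_univ.elim_finite_subcover (fun c : K => ball c (r / 8))
      (fun _ => isOpen_ball)
      (fun c _ => Set.mem_iUnion.2 ⟨c, mem_ball_self (by positivity)⟩)
    refine ⟨r / 8, by positivity, by linarith, T, fun z => ?_, fun c _ => ?_⟩
    · obtain ⟨c, hc, hz⟩ := Set.mem_iUnion₂.1 (hT (Set.mem_univ z))
      exact ⟨c, hc, hz⟩
    · obtain ⟨i, hi⟩ := exists_eq_ciSup_of_finite (f := fun i =>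
        ((packingNumber (K ∩ ball (e i : X) (ε / 2)) r : ENNReal))⁻¹)
      refine lt_of_le_of_lt ?_ (hinv i)
      change (ν _).toReal ≤ _
      rw [← ENNReal.toReal_natCast, ← ENNReal.toReal_inv]
      have hle : ν (closedBall c (2 * (r / 8))) ≤
          ((packingNumber (K ∩ ball (e i : X) (ε / 2)) r : ENNReal))⁻¹ := by
        rw [Measure.bind_apply isClosed_closedBall.measurableSet hmeas.aemeasurable, hi]
        calc _ ≤ ∫⁻ _, (⨆ i, ((packingNumber (K ∩ ball (e i : X) (ε / 2)) r : ENNReal))⁻¹)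
              ∂(μ : Measure K) := lintegral_mono fun y =>
                (hκball (idx y) c).trans (le_iSup (fun i =>
                  ((packingNumber (K ∩ ball (e i : X) (ε / 2)) r : ENNReal))⁻¹) (idx y))
          _ = _ := by simp
      refine ENNReal.toReal_mono ?_ hle
      have hP := one_le_packingNumber (hK.totallyBounded.subset Set.inter_subset_left) hr0
        (E := K ∩ ball (e i : X) (ε / 2)) ⟨e i, (e i).2, mem_ball_self (half_pos hε)⟩
      simpa using Nat.one_le_iff_ne_zero.1 hP
  · change ν B ≤ _
    rw [Measure.bind_apply hB hmeas.aemeasurable]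
    refine le_trans ?_ le_self_add
    rw [← lintegral_indicator_one isOpen_thickening.measurableSet]
    refine lintegral_mono fun y => ?_
    by_cases hy : y ∈ thickening ε B
    · rw [Set.indicator_of_mem hy]
      have := hκprob (idx y)
      exact prob_le_one
    · have hsub : B ⊆ (ball (e (idx y)) (ε / 2))ᶜ := fun z hz hzb => hy <| by
        refine mem_thickening_iff.2 ⟨z, hz, ?_⟩
        have := dist_triangle_right y z (e (idx y))
        linarith [mem_ball.1 hzb, hdist y]
      exact le_of_eq_of_le (measure_mono_null hsub (hκsupp (idx y))) zero_le

/-- A typical measure on an infinite compact `K ⊆ ℝ^d` has upper `L^q`-dimension equal to the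
local uniform upper box dimension of `K`, simultaneously for all `q > 1`. -/
theorem typical_upperDim_eq_locUnif (d : ℕ) (K : Set (Euc d))
    (hK : IsCompact K) (hKinf : K.Infinite) :
    ∃ G : Set (ProbabilityMeasure ↥K),
      G ⊆ {μ : ProbabilityMeasure ↥K |
        ∀ q : ℝ, 1 < q → upperDim (μ : Measure ↥K) q = locUnifUpperBoxDim K} ∧
      Dense G ∧ IsGδ G := by
  have : CompactSpace K := isCompact_iff_compactSpace.1 hK
  let ι := {p : ℚ × ℕ // ((p.1 : ℝ) : EReal) < locUnifUpperBoxDim K}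
  let β := {U : Set K // U ∈ TopologicalSpace.countableBasis K}
  have : Countable β := (TopologicalSpace.countable_countableBasis K).to_subtype
  let A : ι ⊕ β → Set (ProbabilityMeasure K) :=
    Sum.elim (fun p => smallBallMassSet K (p.1.1 : ℝ) p.1.2)
      (fun U => {μ : ProbabilityMeasure K | 0 < (μ : Measure K) U.1})
  have hopen : ∀ a, IsOpen (A a) := by
    rintro (p | U)
    · exact isOpen_smallBallMassSet _ _
    · exact isOpen_setOf_lt_measure
        (TopologicalSpace.isOpen_of_mem_countableBasis U.2) 0
  have hdense : ∀ a, Dense (A a) := by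
    rintro (p | U)
    · exact dense_smallBallMassSet hK p.2 _
    · exact dense_setOf_measure_pos (TopologicalSpace.nonempty_of_mem_countableBasis U.2)
  refine ⟨⋂ a, A a, ?_, dense_iInter_of_isOpen hopen hdense, .iInter_of_isOpen hopen⟩
  intro μ hμ q hq
  have hμA := Set.mem_iInter.1 hμ
  refine le_antisymm (upperDim_le_locUnifUpperBoxDim hK _ (fun U hU hne => ?_) hq) ?_
  · obtain ⟨x, hx⟩ := hne
    obtain ⟨V, hV, -, hVU⟩ :=
      (TopologicalSpace.isBasis_countableBasis K).exists_subset_of_mem_open hx hU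
    exact lt_of_lt_of_le (hμA (Sum.inr ⟨V, hV⟩)) (measure_mono hVU)
  · refine le_of_forall_lt fun c hc => ?_
    obtain ⟨s, hcs, hs⟩ := EReal.lt_iff_exists_rat_btwn.1 hc
    exact hcs.trans_le (le_upperDim_of_mem_smallBallMassSet hq (fun r hr => Iq_pos _ hr hq)
      fun n => hμA (Sum.inl ⟨(s, n), hs⟩))

end
end

section
/- Let K be an infinite compact subset of ℝ^d. Then the set of measures μ ∈ P(K) such that for every q ∈ (0,1) the lower L^q-dimension of μ equals 0 is residual in P(K) (it contains a dense G_δ set). -/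
open MeasureTheory Filter Metric Set Topology

noncomputable section

section TypicalMeasures

open scoped ENNReal

variable {X : Type*} [MetricSpace X]

/-- A scale `r < s`, a finite set `F` that is small relative to `r`, a cover of the space by balls
of radius `r / 2` centered in `T`, and a mass `ε` negligible relative to `#T`. A measure with mass
less than `ε` outside the balls of radius `r / 2` centered in `F` has small `I_μ(r,q)`. -/
structure GoodScale (X : Type*) [MetricSpace X] (s : ℝ) where
  r : ℝ
  r_pos : 0 < r
  r_lt : r < s
  r_lt_one : r < 1
  F : Finset X
  T : Finset X
  ε : ℝ≥0∞
  ε_le : ε ≤ 1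
  cover : (⋃ t ∈ T, ball t (r / 2)) = univ
  card_mul : (T.card : ℝ≥0∞) * ε ^ s ≤ 1
  log_card : Real.log (F.card + 1) ≤ s * -Real.log r

lemma exists_goodScale [CompactSpace X] {s : ℝ} (hs : 0 < s) (F : Finset X) :
    ∃ p : GoodScale X s, p.F = F ∧ 0 < p.ε := by
  have hlog : ∀ᶠ r : ℝ in 𝓝[>] 0, Real.log (F.card + 1) / s ≤ -Real.log r :=
    (tendsto_neg_atBot_atTop.comp Real.tendsto_log_nhdsGT_zero).eventually_ge_atTop _
  obtain ⟨r, hr, hr0, hrs⟩ :=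
    (hlog.and (Ioo_mem_nhdsGT (lt_min hs zero_lt_one))).exists
  obtain ⟨T, -, hTfin, hT⟩ := finite_cover_balls_of_compact (isCompact_univ (X := X)) (half_pos hr0)
  lift T to Finset X using hTfin
  refine ⟨⟨r, hr0, hrs.trans_le (min_le_left _ _), hrs.trans_le (min_le_right _ _), F, T,
    ((T.card + 1 : ℝ≥0∞)⁻¹) ^ s⁻¹, ?_, ?_, ?_, ?_⟩, rfl, ?_⟩
  · exact ENNReal.rpow_le_one (ENNReal.inv_le_one.2 le_add_self) (inv_nonneg.2 hs.le)
  · simpa [univ_subset_iff] using hT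
  · rw [ENNReal.rpow_inv_rpow hs.ne', ← div_eq_mul_inv]
    exact ENNReal.div_le_of_le_mul (by simp)
  · rw [div_le_iff₀ hs] at hr
    linarith
  · exact ENNReal.rpow_pos (ENNReal.inv_pos.2 (by finiteness)) (by simp)

variable [MeasurableSpace X]

lemma ae_measure_ball_pos [SecondCountableTopology X] (μ : Measure X) {r : ℝ} (hr : 0 < r) :
    ∀ᵐ x ∂μ, 0 < μ (ball x r) := by
  refine measure_null_of_locally_null _ fun x hx => ?_
  exact ⟨ball x r, mem_nhdsWithin_of_mem_nhds (ball_mem_nhds x hr), by simpa using hx⟩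

lemma Dq_le_of_Iq_le (μ : Measure X) [IsProbabilityMeasure μ]
    {r q s N : ℝ} (hr0 : 0 < r) (hr1 : r < 1) (hq1 : q < 1) (hN : 1 ≤ N) (hI : Iq μ r q ≤ N)
    (hlog : Real.log N ≤ s * -Real.log r) : Dq μ r q ≤ s / (1 - q) := by
  have hl : 0 < -Real.log r := by linarith [Real.log_neg hr0 hr1]
  have hq : 0 < 1 - q := by linarith
  have hIN : Real.log (Iq μ r q) ≤ Real.log N := by
    rcases le_or_gt (Iq μ r q) 0 with h | h
    · have hI0 : Iq μ r q = 0 := by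
        refine le_antisymm h ?_
        rw [Iq, if_neg hq1.ne]
        exact integral_nonneg fun x => by positivity
      rw [hI0, Real.log_zero]
      exact Real.log_nonneg hN
    · exact Real.log_le_log h hI
  have hD : Dq μ r q = Real.log (Iq μ r q) / -Real.log r / (1 - q) := by
    rw [Dq, if_neg hq1.ne, ← neg_sub 1 q]
    simp only [div_eq_mul_inv, inv_neg]
    ring
  rw [hD]
  gcongr
  rw [div_le_iff₀ hl]
  exact hIN.trans hlog

/-- On a set `A` of diameter less than `r`, the integrand of `I_μ(r,q)` integrates to at most
`μ(A)^q`. -/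
lemma setLIntegral_enorm_ball_rpow_le (μ : Measure X) [IsProbabilityMeasure μ] {r q : ℝ}
    (hq1 : q < 1) {A : Set X} (hA : MeasurableSet A) (hAr : ∀ x ∈ A, A ⊆ ball x r) :
    ∫⁻ x in A, ‖((μ (ball x r)).toReal) ^ (q - 1)‖ₑ ∂μ ≤ μ A ^ q := by
  rcases eq_or_ne (μ A) 0 with h0 | h0
  · rw [setLIntegral_measure_zero _ _ h0]
    exact zero_le
  calc ∫⁻ x in A, ‖((μ (ball x r)).toReal) ^ (q - 1)‖ₑ ∂μ
      ≤ ∫⁻ _ in A, μ A ^ (q - 1) ∂μ := by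
        refine setLIntegral_mono' hA fun x hx => ?_
        have hle : μ A ≤ μ (ball x r) := measure_mono (hAr x hx)
        have hpos : 0 < (μ (ball x r)).toReal :=
          ENNReal.toReal_pos ((pos_iff_ne_zero.2 h0).trans_le hle).ne' (measure_ne_top _ _)
        rw [Real.enorm_eq_ofReal (by positivity), ← ENNReal.ofReal_rpow_of_pos hpos,
          ENNReal.ofReal_toReal (measure_ne_top _ _)]
        rw [← neg_sub 1 q, ENNReal.rpow_neg, ENNReal.rpow_neg]
        exact ENNReal.inv_le_inv.2 (ENNReal.rpow_le_rpow hle (by linarith))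
    _ = μ A ^ q := by
        rw [setLIntegral_const]
        nth_rewrite 2 [← ENNReal.rpow_one (μ A)]
        rw [← ENNReal.rpow_add _ _ h0 (measure_ne_top _ _), sub_add_cancel]

/-- `log I_μ(r,q)` is nonnegative for `q < 1`. -/
lemma log_Iq_nonneg [SecondCountableTopology X] (μ : Measure X) [IsProbabilityMeasure μ]
    {r q : ℝ} (hr : 0 < r) (hq1 : q < 1) : 0 ≤ Real.log (Iq μ r q) := by
  rw [Iq, if_neg hq1.ne]
  by_cases hint : Integrable (fun x => ((μ (ball x r)).toReal) ^ (q - 1)) μ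
  · refine Real.log_nonneg ?_
    calc (1 : ℝ) = ∫ _, (1 : ℝ) ∂μ := by simp
      _ ≤ _ := by
        refine integral_mono_ae (integrable_const _) hint ?_
        filter_upwards [ae_measure_ball_pos μ hr] with x hx
        exact Real.one_le_rpow_of_pos_of_le_one_of_nonpos
          (ENNReal.toReal_pos hx.ne' (measure_ne_top _ _)) measureReal_le_one (by linarith)
  · rw [integral_undef hint, Real.log_zero]

lemma lowerDim_nonneg [SecondCountableTopology X] (μ : Measure X) [IsProbabilityMeasure μ]
    {q : ℝ} (hq1 : q < 1) : 0 ≤ lowerDim μ q := by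
  refine le_liminf_of_le (by isBoundedDefault) ?_
  filter_upwards [Ioo_mem_nhdsGT (zero_lt_one' ℝ)] with r hr
  rw [Dq, if_neg hq1.ne]
  have h1 : Real.log r ≤ 0 := Real.log_nonpos hr.1.le hr.2.le
  exact_mod_cast mul_nonneg_of_nonpos_of_nonpos
    (one_div_nonpos.2 (by linarith))
    (div_nonpos_of_nonneg_of_nonpos (log_Iq_nonneg μ hr.1 hq1) h1)

/-- The open set of measures with small `I_μ(r,q)` at some scale `r < s`. -/
def smallIqSet (X : Type*) [MetricSpace X] [MeasurableSpace X] (s : ℝ) :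
    Set (ProbabilityMeasure X) :=
  ⋃ p : GoodScale X s, {μ | (μ : Measure X) (⋃ x ∈ p.F, ball x (p.r / 2))ᶜ < p.ε}

lemma mem_smallIqSet_of_finite_carrier [CompactSpace X] {s : ℝ} (hs : 0 < s)
    {μ : ProbabilityMeasure X} {F : Finset X} (hF : (μ : Measure X) (F : Set X)ᶜ = 0) :
    μ ∈ smallIqSet X s := by
  obtain ⟨p, rfl, hε⟩ := exists_goodScale hs F
  refine mem_iUnion.2 ⟨p, ?_⟩
  have hnull : (μ : Measure X) (⋃ x ∈ p.F, ball x (p.r / 2))ᶜ = 0 :=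
    measure_mono_null (compl_subset_compl.2 fun x hx =>
      mem_biUnion (Finset.mem_coe.1 hx) (mem_ball_self (half_pos p.r_pos))) hF
  rwa [mem_ofPred_eq, hnull]

variable [BorelSpace X]

/-- If all but mass `ε` of `μ` lies in `#F` balls of radius `r / 2`, and `#T` such balls cover the
space with `#T * ε ^ s ≤ 1`, then `I_μ(r,q) ≤ #F + 1` for `s ≤ q < 1`. -/
lemma Iq_le_card_add_one (μ : Measure X) [IsProbabilityMeasure μ] {r q s : ℝ} {ε : ℝ≥0∞}
    {F T : Finset X} (hs : 0 < s) (hsq : s ≤ q) (hq1 : q < 1)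
    (hε1 : ε ≤ 1) (hT : (⋃ t ∈ T, ball t (r / 2)) = univ) (hεT : (T.card : ℝ≥0∞) * ε ^ s ≤ 1)
    (hF : μ (⋃ x ∈ F, ball x (r / 2))ᶜ < ε) :
    Iq μ r q ≤ F.card + 1 := by
  set U : Set X := ⋃ x ∈ F, ball x (r / 2) with hU
  have hUm : MeasurableSet U := F.measurableSet_biUnion fun _ _ => measurableSet_ball
  have hball : ∀ t : X, ∀ x ∈ ball t (r / 2), ball t (r / 2) ⊆ ball x r := by
    intro t x hx y hy
    rw [mem_ball] at *
    linarith [dist_triangle_right y x t]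
  have hcov : (univ : Set X) =
      (⋃ i : F, ball i.1 (r / 2)) ∪ ⋃ t : T, ball t.1 (r / 2) ∩ Uᶜ := by
    refine (eq_univ_of_forall fun x => ?_).symm
    by_cases hx : x ∈ U
    · left
      simpa [hU] using hx
    · right
      have hxT : x ∈ ⋃ t ∈ T, ball t (r / 2) := hT ▸ mem_univ x
      simp only [mem_iUnion, exists_prop] at hxT
      obtain ⟨t, ht, hxt⟩ := hxT
      exact mem_iUnion.2 ⟨⟨t, ht⟩, hxt, hx⟩
  have hlint : ∫⁻ x, ‖((μ (ball x r)).toReal) ^ (q - 1)‖ₑ ∂μ ≤ F.card + 1 := by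
    rw [← setLIntegral_univ, hcov]
    refine (lintegral_union_le _ _ _).trans (add_le_add ?_ ?_)
    · refine (lintegral_iUnion_le _ _).trans ?_
      rw [tsum_fintype]
      calc _ ≤ ∑ _ : F, (1 : ℝ≥0∞) := Finset.sum_le_sum fun i _ =>
            (setLIntegral_enorm_ball_rpow_le μ hq1 measurableSet_ball (hball i)).trans
              (ENNReal.rpow_le_one prob_le_one (hs.le.trans hsq))
        _ = F.card := by simp
    · refine (lintegral_iUnion_le _ _).trans ?_
      rw [tsum_fintype]
      calc _ ≤ ∑ _ : T, ε ^ s := Finset.sum_le_sum fun t _ => by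
            refine (setLIntegral_enorm_ball_rpow_le μ hq1
              (measurableSet_ball.inter hUm.compl)
              fun x hx => inter_subset_left.trans (hball t x hx.1)).trans ?_
            calc μ (ball t.1 (r / 2) ∩ Uᶜ) ^ q ≤ ε ^ q :=
                  ENNReal.rpow_le_rpow ((measure_mono inter_subset_right).trans hF.le)
                    (hs.le.trans hsq)
              _ ≤ ε ^ s := ENNReal.rpow_le_rpow_of_exponent_ge hε1 hsq
        _ ≤ 1 := by simpa using hεT
  rw [Iq, if_neg hq1.ne]
  calc _ ≤ ‖∫ x, ((μ (ball x r)).toReal) ^ (q - 1) ∂μ‖ := Real.le_norm_self _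
    _ ≤ _ := norm_integral_le_lintegral_norm _
    _ ≤ ((F.card : ℝ≥0∞) + 1).toReal := by
        refine ENNReal.toReal_mono (by finiteness) ?_
        simpa only [ofReal_norm] using hlint
    _ = F.card + 1 := by
        rw [ENNReal.toReal_add (by simp) (by simp)]
        simp

lemma isOpen_setOf_measure_lt_s3 {C : Set X} (hC : IsClosed C) (ε : ℝ≥0∞) :
    IsOpen {μ : ProbabilityMeasure X | (μ : Measure X) C < ε} := by
  refine isOpen_iff_mem_nhds.2 fun μ hμ => ?_
  exact eventually_lt_of_limsup_lt
    ((ProbabilityMeasure.limsup_measure_closed_le_of_tendsto tendsto_id hC).trans_lt hμ)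

/-- Probability measures concentrated on a finite set are dense. -/
lemma dense_finite_carrier [SecondCountableTopology X] :
    Dense {μ : ProbabilityMeasure X | ∃ F : Finset X, (μ : Measure X) (F : Set X)ᶜ = 0} := by
  intro μ
  obtain ⟨y₀⟩ : Nonempty X := μ.nonempty
  let f : ℕ → SimpleFunc X X := SimpleFunc.approxOn id measurable_id univ y₀ (mem_univ _)
  have hf : ∀ x, Tendsto (fun n => f n x) atTop (𝓝 x) := fun x =>
    SimpleFunc.tendsto_approxOn measurable_id (mem_univ y₀) (by simp)
  have hfm : ∀ n, AEMeasurable (f n) (μ : Measure X) := fun n => (f n).measurable.aemeasurable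
  have hlim : Tendsto (fun n => μ.map (hfm n)) atTop (𝓝 μ) := by
    rw [ProbabilityMeasure.tendsto_iff_forall_integral_tendsto]
    intro g
    have hmap : ∀ n, ∫ x, g x ∂(μ.map (hfm n) : Measure X) = ∫ x, g (f n x) ∂(μ : Measure X) :=
      fun n => integral_map (hfm n) g.continuous.aestronglyMeasurable
    simp only [hmap]
    refine tendsto_integral_of_dominated_convergence (fun _ => ‖g‖)
      (fun n => (g.continuous.measurable.comp (f n).measurable).aestronglyMeasurable)
      (integrable_const _) (fun n => ae_of_all _ fun x => g.norm_coe_le_norm _)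
      (ae_of_all _ fun x => (g.continuous.tendsto x).comp (hf x))
  refine mem_closure_of_tendsto hlim (Eventually.of_forall fun n => ⟨(f n).range, ?_⟩)
  rw [ProbabilityMeasure.toMeasure_map,
    Measure.map_apply (f n).measurable (Finset.measurableSet _).compl]
  convert measure_empty (μ := (μ : Measure X))
  ext x
  simp

lemma isOpen_smallIqSet (s : ℝ) : IsOpen (smallIqSet X s) :=
  isOpen_iUnion fun _ => isOpen_setOf_measure_lt_s3
    (isOpen_biUnion fun _ _ => isOpen_ball).isClosed_compl _

lemma exists_Dq_le_of_mem_smallIqSet [SecondCountableTopology X] {s q : ℝ} (hs : 0 < s)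
    (hsq : s ≤ q) (hq1 : q < 1) {μ : ProbabilityMeasure X} (hμ : μ ∈ smallIqSet X s) :
    ∃ r, 0 < r ∧ r < s ∧ Dq (μ : Measure X) r q ≤ s / (1 - q) := by
  obtain ⟨p, hp⟩ := mem_iUnion.1 hμ
  exact ⟨p.r, p.r_pos, p.r_lt, Dq_le_of_Iq_le _ p.r_pos p.r_lt_one hq1 (by simp)
    (Iq_le_card_add_one _ hs hsq hq1 p.ε_le p.cover p.card_mul hp) p.log_card⟩

lemma lowerDim_eq_zero_of_forall_mem_smallIqSet [SecondCountableTopology X]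
    {μ : ProbabilityMeasure X} (hμ : ∀ n : ℕ, μ ∈ smallIqSet X (1 / ((n : ℝ) + 1)))
    {q : ℝ} (hq0 : 0 < q) (hq1 : q < 1) : lowerDim (μ : Measure X) q = 0 := by
  refine le_antisymm (EReal.le_of_forall_lt_iff_le.1 fun z hz => ?_) (lowerDim_nonneg _ hq1)
  have hz0 : 0 < z := by exact_mod_cast hz
  have hq : 0 < 1 - q := by linarith
  refine liminf_le_of_frequently_le' ((nhdsGT_basis (0 : ℝ)).frequently_iff.2 fun b hb => ?_)
  obtain ⟨n, hn⟩ := exists_nat_one_div_lt (lt_min hb (lt_min hq0 (mul_pos hz0 hq)))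
  obtain ⟨hnb, hnq, hnz⟩ : _ ∧ _ ∧ _ := by simpa only [lt_min_iff] using hn
  obtain ⟨r, hr0, hrs, hD⟩ :=
    exists_Dq_le_of_mem_smallIqSet (by positivity) hnq.le hq1 (hμ n)
  exact ⟨r, ⟨hr0, hrs.trans hnb⟩,
    EReal.coe_le_coe_iff.2 (hD.trans ((div_le_iff₀ hq).2 hnz.le))⟩

end TypicalMeasures

/-- A typical measure on an infinite compact `K ⊆ ℝ^d` has lower `L^q`-dimension equal to `0`,
simultaneously for all `q ∈ (0,1)`. -/
theorem typical_lowerDim_eq_zero_q_in_01 (d : ℕ) (K : Set (Euc d))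
    (hK : IsCompact K) (hKinf : K.Infinite) :
    ∃ G : Set (ProbabilityMeasure ↥K),
      G ⊆ {μ : ProbabilityMeasure ↥K |
        ∀ q : ℝ, q ∈ Set.Ioo (0:ℝ) 1 → lowerDim (μ : Measure ↥K) q = (0 : EReal)} ∧
      Dense G ∧ IsGδ G := by
  have : CompactSpace K := isCompact_iff_compactSpace.1 hK
  refine ⟨⋂ n : ℕ, smallIqSet K (1 / ((n : ℝ) + 1)), ?_, ?_, ?_⟩
  · exact fun μ hμ q hq =>
      lowerDim_eq_zero_of_forall_mem_smallIqSet (mem_iInter.1 hμ) hq.1 hq.2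
  · refine dense_finite_carrier.mono ?_
    rintro μ ⟨F, hF⟩
    exact mem_iInter.2 fun n => mem_smallIqSet_of_finite_carrier (by positivity) hF
  · exact .iInter_of_isOpen fun n => isOpen_smallIqSet _

end
end
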